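/- Let Δ > 0 and τ > 0 be real numbers with Δ + τ < π/2. Then cos(Δ + τ)/cos(τ) < exp(−(Δ²/2 + τ·Δ)). -/

import Mathlib

/-- The ratio of the cosine to the Gaussian `exp (-x ^ 2 / 2)` is strictly decreasing. -/
theorem strictAntiOn_cos_mul_exp_sq_div_two :
    StrictAntiOn (fun x : ℝ => Real.cos x * Real.exp (x ^ 2 / 2)) (Set.Ico 0 (Real.pi / 2)) := by
  refine strictAntiOn_of_hasDerivWithinAt_neg
    (f' := fun x => (x * Real.cos x - Real.sin x) * Real.exp (x ^ 2 / 2))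
    (convex_Ico _ _) (by fun_prop) (fun x _ => HasDerivAt.hasDerivWithinAt ?_) fun x hx => ?_
  · have hsq : HasDerivAt (fun y : ℝ => y ^ 2 / 2) x x := by
      simpa using (hasDerivAt_pow 2 x).div_const 2
    exact ((Real.hasDerivAt_cos x).fun_mul hsq.exp).congr_deriv (by ring)
  · rw [interior_Ico] at hx
    have hcos : 0 < Real.cos x := Real.cos_pos_of_mem_Ioo ⟨by linarith [hx.1, hx.2], hx.2⟩
    have htan := Real.lt_tan hx.1 hx.2
    rw [Real.tan_eq_sin_div_cos, lt_div_iff₀ hcos] at htan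
    exact mul_neg_of_neg_of_pos (sub_neg.mpr htan) (Real.exp_pos _)

theorem stmt_14 (Δ τ : ℝ) (hΔ : 0 < Δ) (hτ : 0 < τ) (hsum : Δ + τ < Real.pi / 2) :
    Real.cos (Δ + τ) / Real.cos τ < Real.exp (-(Δ ^ 2 / 2 + τ * Δ)) := by
  have hcos : 0 < Real.cos τ := Real.cos_pos_of_mem_Ioo ⟨by linarith, by linarith⟩
  have hanti : Real.cos (Δ + τ) * Real.exp ((Δ + τ) ^ 2 / 2) < Real.cos τ * Real.exp (τ ^ 2 / 2) :=
    strictAntiOn_cos_mul_exp_sq_div_two ⟨hτ.le, by linarith⟩ ⟨by linarith, hsum⟩ (by linarith)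
  have hexp : Real.exp (-(Δ ^ 2 / 2 + τ * Δ)) =
      Real.exp (τ ^ 2 / 2) / Real.exp ((Δ + τ) ^ 2 / 2) := by
    rw [← Real.exp_sub]
    ring_nf
  rw [hexp, div_lt_div_iff₀ hcos (Real.exp_pos _)]
  linarith
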